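/- arXiv:1804.06123 — 2 statements merged into one kernel-verified Lean document; each statement's English description precedes it below -/
import Mathlib

section
/- Under the adapted cuspidal-edge setting, a point p = (u₀,0) of the u-axis is an elliptic point of the focal surface ŴFC_f (K_{ŴFC}(p) > 0) if and only if 4κ_t(u₀)² + κ_s(u₀)κ_c(u₀)² < 0; it is a parabolic point (K_{ŴFC}(p) = 0) if and only if 4κ_t(u₀)² + κ_s(u₀)κ_c(u₀)² = 0; and it is a hyperbolic point (K_{ŴFC}(p) < 0) if and only if 4κ_t(u₀)² + κ_s(u₀)κ_c(u₀)² > 0. -/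
noncomputable section

local notation "⟪" x ", " y "⟫" => @inner ℝ _ _ x y

/-- Euclidean 3-space. -/
abbrev E3 : Type := EuclideanSpace ℝ (Fin 3)

/-- The vector in `E3` with coordinates `(a, b, c)`. -/
def e3 (a b c : ℝ) : E3 := (WithLp.equiv 2 (Fin 3 → ℝ)).symm ![a, b, c]

/-- Cross product on `E3`. -/
def cross3 (a b : E3) : E3 :=
  e3 (a 1 * b 2 - a 2 * b 1) (a 2 * b 0 - a 0 * b 2) (a 0 * b 1 - a 1 * b 0)

/-- Scalar triple product `det(a,b,c)`. -/
def det3 (a b c : E3) : ℝ := ⟪a, cross3 b c⟫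

/-- Partial derivative in the `u`-direction. -/
def pu {E : Type*} [NormedAddCommGroup E] [NormedSpace ℝ E] (g : ℝ × ℝ → E) (p : ℝ × ℝ) : E :=
  fderiv ℝ g p (1, 0)

/-- Partial derivative in the `v`-direction. -/
def pv {E : Type*} [NormedAddCommGroup E] [NormedSpace ℝ E] (g : ℝ × ℝ → E) (p : ℝ × ℝ) : E :=
  fderiv ℝ g p (0, 1)

/-- Signed area density `λ = det(f_u, f_v, ν)`. -/
def lam (f ν : ℝ × ℝ → E3) (p : ℝ × ℝ) : ℝ := det3 (pu f p) (pv f p) (ν p)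


/-- `Ẽ = |f_u|²`. -/
def Etil (f : ℝ × ℝ → E3) (p : ℝ × ℝ) : ℝ := ‖pu f p‖ ^ 2

/-- `F̃ = ⟨f_u, h⟩`. -/
def Ftil (f h : ℝ × ℝ → E3) (p : ℝ × ℝ) : ℝ := ⟪pu f p, h p⟫

/-- `G̃ = |h|²`. -/
def Gtil (h : ℝ × ℝ → E3) (p : ℝ × ℝ) : ℝ := ‖h p‖ ^ 2

/-- `L̃ = −⟨f_u, ν_u⟩`. -/
def Ltil (f ν : ℝ × ℝ → E3) (p : ℝ × ℝ) : ℝ := -⟪pu f p, pu ν p⟫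

/-- `M̃ = −⟨h, ν_u⟩`. -/
def Mtil (ν h : ℝ × ℝ → E3) (p : ℝ × ℝ) : ℝ := -⟪h p, pu ν p⟫

/-- `Ñ = −⟨h, ν_v⟩`. -/
def Ntil (ν h : ℝ × ℝ → E3) (p : ℝ × ℝ) : ℝ := -⟪h p, pv ν p⟫

/-- `Ã = ẼÑ − 2vF̃M̃ + vG̃L̃`. -/
def Atil (f ν h : ℝ × ℝ → E3) (p : ℝ × ℝ) : ℝ :=
  Etil f p * Ntil ν h p - 2 * p.2 * Ftil f h p * Mtil ν h p + p.2 * Gtil h p * Ltil f ν p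

/-- `B̃ = √(Ã² − 4v(ẼG̃−F̃²)(L̃Ñ−vM̃²))`. -/
def Btil (f ν h : ℝ × ℝ → E3) (p : ℝ × ℝ) : ℝ :=
  Real.sqrt ((Atil f ν h p) ^ 2 -
    4 * p.2 * (Etil f p * Gtil h p - (Ftil f h p) ^ 2) *
      (Ltil f ν p * Ntil ν h p - p.2 * (Mtil ν h p) ^ 2))

/-- The bounded principal curvature `κ = 2(L̃Ñ−vM̃²)/(Ã+B̃)`. -/
def kap (f ν h : ℝ × ℝ → E3) (p : ℝ × ℝ) : ℝ :=
  2 * (Ltil f ν p * Ntil ν h p - p.2 * (Mtil ν h p) ^ 2) / (Atil f ν h p + Btil f ν h p)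

/-- `κ̂ = (Ã+B̃)/(2|f_u×h|)`, the smooth extension of `λ·κ₁`. -/
def kaphat (f ν h : ℝ × ℝ → E3) (p : ℝ × ℝ) : ℝ :=
  (Atil f ν h p + Btil f ν h p) / (2 * ‖cross3 (pu f p) (h p)‖)

/-- Singular curvature `κ_s` along the u-axis. -/
def kappas (f ν : ℝ × ℝ → E3) (u : ℝ) : ℝ :=
  det3 (pu f (u, 0)) (pu (pu f) (u, 0)) (ν (u, 0)) / ‖pu f (u, 0)‖ ^ 3

/-- Cuspidal curvature `κ_c` along the u-axis. -/
def kappac (f ν h : ℝ × ℝ → E3) (u : ℝ) : ℝ :=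
  2 * Etil f (u, 0) ^ ((3 : ℝ) / 4) * Ntil ν h (u, 0) /
    (Etil f (u, 0) * Gtil h (u, 0) - (Ftil f h (u, 0)) ^ 2) ^ ((3 : ℝ) / 4)

/-- Cusp-directional torsion `κ_t` along the u-axis. -/
def kappat (f ν h : ℝ × ℝ → E3) (u : ℝ) : ℝ :=
  (Etil f (u, 0) * Mtil ν h (u, 0) - Ftil f h (u, 0) * Ltil f ν (u, 0)) /
    (Etil f (u, 0) * Real.sqrt (Etil f (u, 0) * Gtil h (u, 0) - (Ftil f h (u, 0)) ^ 2))

/-- The focal surface `ŴFC_f = f + (λ/κ̂)ν`. -/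
def FChat (f ν h : ℝ × ℝ → E3) (p : ℝ × ℝ) : E3 :=
  f p + (lam f ν p / kaphat f ν h p) • ν p

/-- Coefficient `E` of the first fundamental form of a surface `W`. -/
def surfE (W : ℝ × ℝ → E3) (p : ℝ × ℝ) : ℝ := ‖pu W p‖ ^ 2

/-- Coefficient `F` of the first fundamental form of a surface `W`. -/
def surfF (W : ℝ × ℝ → E3) (p : ℝ × ℝ) : ℝ := ⟪pu W p, pv W p⟫

/-- Coefficient `G` of the first fundamental form of a surface `W`. -/
def surfG (W : ℝ × ℝ → E3) (p : ℝ × ℝ) : ℝ := ‖pv W p‖ ^ 2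

/-- Unit normal `n = (W_u × W_v)/|W_u × W_v|` of a surface `W`. -/
def surfn (W : ℝ × ℝ → E3) (p : ℝ × ℝ) : E3 :=
  ‖cross3 (pu W p) (pv W p)‖⁻¹ • cross3 (pu W p) (pv W p)

/-- Coefficient `L = ⟨W_uu, n⟩` of the second fundamental form. -/
def surfL (W : ℝ × ℝ → E3) (p : ℝ × ℝ) : ℝ := ⟪pu (pu W) p, surfn W p⟫

/-- Coefficient `M = ⟨W_uv, n⟩` of the second fundamental form. -/
def surfM (W : ℝ × ℝ → E3) (p : ℝ × ℝ) : ℝ := ⟪pv (pu W) p, surfn W p⟫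

/-- Coefficient `N = ⟨W_vv, n⟩` of the second fundamental form. -/
def surfN (W : ℝ × ℝ → E3) (p : ℝ × ℝ) : ℝ := ⟪pv (pv W) p, surfn W p⟫

/-- Gaussian curvature of a surface `W`. -/
def gaussK (W : ℝ × ℝ → E3) (p : ℝ × ℝ) : ℝ :=
  (surfL W p * surfN W p - (surfM W p) ^ 2) /
    (surfE W p * surfG W p - (surfF W p) ^ 2)

/-- Mean curvature of a surface `W` (w.r.t. the unit normal `surfn W`). -/
def meanH (W : ℝ × ℝ → E3) (p : ℝ × ℝ) : ℝ :=
  (surfE W p * surfN W p - 2 * surfF W p * surfM W p + surfG W p * surfL W p) /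
    (2 * (surfE W p * surfG W p - (surfF W p) ^ 2))


open Filter Topology

section PartialDerivatives

variable {E : Type*} [NormedAddCommGroup E] [NormedSpace ℝ E] {g g₁ g₂ : ℝ × ℝ → E} {p : ℝ × ℝ}

theorem Filter.EventuallyEq.pu (hg : g₁ =ᶠ[𝓝 p] g₂) : _root_.pu g₁ =ᶠ[𝓝 p] _root_.pu g₂ :=
  hg.fderiv.fun_comp (fun L => L (1, 0))

theorem Filter.EventuallyEq.pv (hg : g₁ =ᶠ[𝓝 p] g₂) : _root_.pv g₁ =ᶠ[𝓝 p] _root_.pv g₂ :=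
  hg.fderiv.fun_comp (fun L => L (0, 1))

theorem ContDiffAt.pu (hg : ContDiffAt ℝ (⊤ : ℕ∞) g p) :
    ContDiffAt ℝ (⊤ : ℕ∞) (_root_.pu g) p :=
  (hg.fderiv_right (m := (⊤ : ℕ∞)) le_rfl).clm_apply contDiffAt_const

theorem ContDiffAt.pv (hg : ContDiffAt ℝ (⊤ : ℕ∞) g p) :
    ContDiffAt ℝ (⊤ : ℕ∞) (_root_.pv g) p :=
  (hg.fderiv_right (m := (⊤ : ℕ∞)) le_rfl).clm_apply contDiffAt_const

theorem ContDiffAt.differentiableAt_of_top (hg : ContDiffAt ℝ (⊤ : ℕ∞) g p) :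
    DifferentiableAt ℝ g p :=
  hg.differentiableAt (by simp)

theorem ContDiffAt.eventually_of_top (hg : ContDiffAt ℝ (⊤ : ℕ∞) g p) :
    ∀ᶠ q in 𝓝 p, DifferentiableAt ℝ g q := by
  have h1 : ContDiffAt ℝ 1 g p := hg.of_le (by exact_mod_cast le_top)
  exact (h1.eventually (by simp)).mono fun q hq => hq.differentiableAt (by simp)

theorem pv_pu_comm (hg : ContDiffAt ℝ (⊤ : ℕ∞) g p) : pv (pu g) p = pu (pv g) p := by
  have hd : DifferentiableAt ℝ (fderiv ℝ g) p :=
    (hg.fderiv_right (m := (⊤ : ℕ∞)) le_rfl).differentiableAt (by simp)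
  have hs : IsSymmSndFDerivAt ℝ g p :=
    (hg.of_le (WithTop.coe_le_coe.2 (le_top : (2 : ℕ∞) ≤ ⊤))).isSymmSndFDerivAt (by simp)
  have h1 : pv (pu g) p = fderiv ℝ (fderiv ℝ g) p (0, 1) (1, 0) := by
    unfold pv pu
    rw [fderiv_clm_apply hd (differentiableAt_const _)]
    simp
  have h2 : pu (pv g) p = fderiv ℝ (fderiv ℝ g) p (1, 0) (0, 1) := by
    unfold pv pu
    rw [fderiv_clm_apply hd (differentiableAt_const _)]
    simp
  rw [h1, h2, hs]

theorem pu_add (h₁ : DifferentiableAt ℝ g₁ p) (h₂ : DifferentiableAt ℝ g₂ p) :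
    pu (fun q => g₁ q + g₂ q) p = pu g₁ p + pu g₂ p := by
  simp [pu, fderiv_fun_add h₁ h₂]

theorem pv_add (h₁ : DifferentiableAt ℝ g₁ p) (h₂ : DifferentiableAt ℝ g₂ p) :
    pv (fun q => g₁ q + g₂ q) p = pv g₁ p + pv g₂ p := by
  simp [pv, fderiv_fun_add h₁ h₂]

theorem pu_smul {s : ℝ × ℝ → ℝ} (hs : DifferentiableAt ℝ s p) (hg : DifferentiableAt ℝ g p) :
    pu (fun q => s q • g q) p = s p • pu g p + pu s p • g p := by
  simp [pu, fderiv_fun_smul hs hg]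

theorem pv_smul {s : ℝ × ℝ → ℝ} (hs : DifferentiableAt ℝ s p) (hg : DifferentiableAt ℝ g p) :
    pv (fun q => s q • g q) p = s p • pv g p + pv s p • g p := by
  simp [pv, fderiv_fun_smul hs hg]

theorem pu_snd_smul (hg : DifferentiableAt ℝ g p) :
    pu (fun q => q.2 • g q) p = p.2 • pu g p := by
  rw [pu_smul differentiableAt_snd hg]
  simp [pu, fderiv_snd]

theorem pv_snd_smul (hg : DifferentiableAt ℝ g p) :
    pv (fun q => q.2 • g q) p = p.2 • pv g p + g p := by
  rw [pv_smul differentiableAt_snd hg]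
  simp [pv, fderiv_snd]

/-- The 2-jet at an axis point of `W = f + v g`, where `f_v = v h`. -/
theorem jet_add_snd_smul {W f g h : ℝ × ℝ → E} {u : ℝ}
    (hf : ContDiffAt ℝ (⊤ : ℕ∞) f (u, 0)) (hg : ContDiffAt ℝ (⊤ : ℕ∞) g (u, 0))
    (hh : ContDiffAt ℝ (⊤ : ℕ∞) h (u, 0))
    (hfv : pv f =ᶠ[𝓝 (u, 0)] fun q => q.2 • h q)
    (hW : W =ᶠ[𝓝 (u, 0)] fun q => f q + q.2 • g q) :
    pu W (u, 0) = pu f (u, 0) ∧ pv W (u, 0) = g (u, 0) ∧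
      pu (pu W) (u, 0) = pu (pu f) (u, 0) ∧ pv (pu W) (u, 0) = pu g (u, 0) ∧
      pv (pv W) (u, 0) = h (u, 0) + (2 : ℝ) • pv g (u, 0) := by
  have hvg : ∀ᶠ q in 𝓝 (u, (0 : ℝ)), DifferentiableAt ℝ (fun q => q.2 • g q) q :=
    hg.eventually_of_top.mono fun q hq => differentiableAt_snd.smul hq
  have hWu : pu W =ᶠ[𝓝 (u, 0)] fun q => pu f q + q.2 • pu g q := by
    filter_upwards [hW.pu, hf.eventually_of_top, hg.eventually_of_top, hvg] with q h1 h2 h3 h4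
    rw [h1, pu_add h2 h4, pu_snd_smul h3]
  have hWv : pv W =ᶠ[𝓝 (u, 0)] fun q => g q + q.2 • (h q + pv g q) := by
    filter_upwards [hW.pv, hf.eventually_of_top, hg.eventually_of_top, hvg, hfv] with
      q h1 h2 h3 h4 h5
    rw [h1, pv_add h2 h4, pv_snd_smul h3, h5, smul_add]
    abel
  have dg := hg.differentiableAt_of_top
  have dgu := hg.pu.differentiableAt_of_top
  have dgv := hg.pv.differentiableAt_of_top
  have dh := hh.differentiableAt_of_top
  have dfu := hf.pu.differentiableAt_of_top
  have dvgu : DifferentiableAt ℝ (fun q => q.2 • pu g q) (u, 0) := differentiableAt_snd.smul dgu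
  have dhgv : DifferentiableAt ℝ (fun q => h q + pv g q) (u, 0) := dh.add dgv
  have dvhgv : DifferentiableAt ℝ (fun q => q.2 • (h q + pv g q)) (u, 0) :=
    differentiableAt_snd.smul dhgv
  refine ⟨by simpa using hWu.eq_of_nhds, by simpa using hWv.eq_of_nhds, ?_, ?_, ?_⟩
  · rw [hWu.pu.eq_of_nhds, pu_add dfu dvgu, pu_snd_smul dgu]
    simp
  · rw [hWu.pv.eq_of_nhds, pv_add dfu dvgu, pv_snd_smul dgu,
      pv_pu_comm hf, hfv.pu.eq_of_nhds, pu_snd_smul dh]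
    simp
  · rw [hWv.pv.eq_of_nhds, pv_add dg dvhgv,
      pv_snd_smul dhgv, two_smul]
    simp only [zero_smul, zero_add]
    abel

end PartialDerivatives

section CrossProduct

theorem inner_E3 (a b : E3) : ⟪a, b⟫ = a 0 * b 0 + a 1 * b 1 + a 2 * b 2 := by
  simp [PiLp.inner_apply, Fin.sum_univ_three, mul_comm]

@[simp] theorem cross3_zero (a b : E3) : cross3 a b 0 = a 1 * b 2 - a 2 * b 1 := rfl

@[simp] theorem cross3_one (a b : E3) : cross3 a b 1 = a 2 * b 0 - a 0 * b 2 := rfl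

@[simp] theorem cross3_two (a b : E3) : cross3 a b 2 = a 0 * b 1 - a 1 * b 0 := rfl

theorem cross3_smul_right (c : ℝ) (a b : E3) : cross3 a (c • b) = c • cross3 a b := by
  ext i
  fin_cases i <;> simp <;> ring

theorem norm_cross3_sq (a b : E3) : ‖cross3 a b‖ ^ 2 = ‖a‖ ^ 2 * ‖b‖ ^ 2 - ⟪a, b⟫ ^ 2 := by
  simp only [← real_inner_self_eq_norm_sq, inner_E3, cross3_zero, cross3_one, cross3_two]
  ring

theorem cross3_cross3_self (a b : E3) :
    cross3 a (cross3 a b) = ⟪a, b⟫ • a - ‖a‖ ^ 2 • b := by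
  simp only [← real_inner_self_eq_norm_sq, inner_E3]
  ext i
  fin_cases i <;> simp <;> ring

theorem det3_swap (a b c : E3) : det3 a b c = -⟪b, cross3 a c⟫ := by
  simp only [det3, inner_E3, cross3_zero, cross3_one, cross3_two]
  ring

theorem det3_smul_self_cross3 (a b : E3) (v d : ℝ) :
    det3 a (v • b) (d • cross3 a b) = v * d * ‖cross3 a b‖ ^ 2 := by
  simp only [← real_inner_self_eq_norm_sq, det3, inner_E3, cross3_zero, cross3_one, cross3_two,
    PiLp.smul_apply, smul_eq_mul]
  ring

end CrossProduct

theorem rpow_three_quarters_sq {x : ℝ} (hx : 0 ≤ x) : ((x ^ 2) ^ ((3 : ℝ) / 4)) ^ 2 = x ^ 3 := by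
  rw [← Real.rpow_natCast x 2, ← Real.rpow_mul hx, ← Real.rpow_natCast, ← Real.rpow_mul hx,
    ← Real.rpow_natCast]
  norm_num

/-- The Gaussian curvature from a 2-jet with `W_u = a` and `W_v = σ ν`, where `ν` is the unit
normal of `a` and `b`. -/
theorem gaussK_eq_of_jet {W : ℝ × ℝ → E3} {p : ℝ × ℝ} {a b ν : E3} {σ : ℝ}
    (ha : 0 < ‖a‖) (hD : 0 < ‖cross3 a b‖) (hσ : 0 < σ)
    (hν : ν = ‖cross3 a b‖⁻¹ • cross3 a b)
    (hu : pu W p = a) (hv : pv W p = σ • ν) :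
    gaussK W p =
      (⟪pu (pu W) p, cross3 a ν⟫ * ⟪pv (pv W) p, cross3 a ν⟫ - ⟪pv (pu W) p, cross3 a ν⟫ ^ 2) /
        (‖a‖ ^ 4 * σ ^ 2) := by
  have hν1 : ‖ν‖ = 1 := by
    rw [hν, norm_smul, norm_inv, norm_norm, inv_mul_cancel₀ hD.ne']
  have h_perp : ⟪a, ν⟫ = 0 := by
    rw [hν, real_inner_smul_right]
    simp only [inner_E3, cross3_zero, cross3_one, cross3_two]
    ring
  have hc : ‖cross3 a ν‖ ^ 2 = ‖a‖ ^ 2 := by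
    rw [norm_cross3_sq, hν1, h_perp]
    ring
  have hc' : ‖cross3 a ν‖ = ‖a‖ := by
    rwa [sq_eq_sq₀ (norm_nonneg _) (norm_nonneg _)] at hc
  have hn : surfn W p = ‖a‖⁻¹ • cross3 a ν := by
    rw [surfn, hu, hv, cross3_smul_right, norm_smul, hc', smul_smul, Real.norm_of_nonneg hσ.le]
    congr 1
    field_simp
  simp only [gaussK, surfL, surfM, surfN, surfE, surfF, surfG, hn, hu, hv, real_inner_smul_right,
    h_perp, norm_smul, hν1, Real.norm_of_nonneg hσ.le]
  field_simp
  ring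

/-- At an axis point, the Gaussian curvature of the focal surface of a cuspidal edge is
`-(4κ_t² + κ_s κ_c²) / 4`. -/
theorem gaussK_FChat_eq {U : Set (ℝ × ℝ)} (hU : IsOpen U) {f ν h : ℝ × ℝ → E3}
    (hf : ContDiffOn ℝ (⊤ : ℕ∞) f U) (hν : ContDiffOn ℝ (⊤ : ℕ∞) ν U)
    (hh : ContDiffOn ℝ (⊤ : ℕ∞) h U)
    (hν1 : ∀ p ∈ U, ‖ν p‖ = 1)
    (ho1 : ∀ p ∈ U, (⟪pu f p, ν p⟫ : ℝ) = 0)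
    (hfv : ∀ p ∈ U, pv f p = p.2 • h p)
    (hνdef : ∀ p ∈ U, ν p = ‖cross3 (pu f p) (h p)‖⁻¹ • cross3 (pu f p) (h p))
    (hNpos : ∀ p ∈ U, p.2 = 0 → 0 < Ntil ν h p)
    {u₀ : ℝ} (hp : ((u₀, 0) : ℝ × ℝ) ∈ U) :
    gaussK (FChat f ν h) (u₀, 0) =
      -(4 * (kappat f ν h u₀) ^ 2 + kappas f ν u₀ * (kappac f ν h u₀) ^ 2) / 4 := by
  have hUn : U ∈ 𝓝 ((u₀, 0) : ℝ × ℝ) := hU.mem_nhds hp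
  have cf := hf.contDiffAt hUn
  have cν := hν.contDiffAt hUn
  have ch := hh.contDiffAt hUn
  have hD : ∀ q ∈ U, 0 < ‖cross3 (pu f q) (h q)‖ := by
    intro q hq
    refine (norm_nonneg _).lt_of_ne fun h0 => ?_
    have h1 := hν1 q hq
    rw [hνdef q hq, ← h0] at h1
    simp at h1
  have ha : 0 < ‖pu f (u₀, 0)‖ := by
    refine (norm_nonneg _).lt_of_ne fun h0 => ?_
    have h1 := hD _ hp
    have h2 := norm_cross3_sq (pu f (u₀, 0)) (h (u₀, 0))
    rw [norm_eq_zero.mp h0.symm] at h1 h2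
    simp only [norm_zero, inner_zero_left] at h2
    nlinarith
  have hN := hNpos _ hp rfl
  -- `λ / κ̂ = v σ` with `σ` smooth
  let σ : ℝ × ℝ → ℝ := fun q =>
    2 * (Etil f q * Gtil h q - Ftil f h q ^ 2) / (Atil f ν h q + Btil f ν h q)
  have hA0 : 0 < Atil f ν h (u₀, 0) := by
    simp only [Atil, Etil]
    ring_nf
    positivity
  have hB0 : Btil f ν h (u₀, 0) = Atil f ν h (u₀, 0) := by
    simp only [Btil, mul_zero, zero_mul, sub_zero]
    exact Real.sqrt_sq hA0.le
  have cE : ContDiffAt ℝ (⊤ : ℕ∞) (Etil f) (u₀, 0) := cf.pu.norm_sq ℝ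
  have cG : ContDiffAt ℝ (⊤ : ℕ∞) (Gtil h) (u₀, 0) := ch.norm_sq ℝ
  have cF : ContDiffAt ℝ (⊤ : ℕ∞) (Ftil f h) (u₀, 0) := cf.pu.inner ℝ ch
  have cL : ContDiffAt ℝ (⊤ : ℕ∞) (Ltil f ν) (u₀, 0) := (cf.pu.inner ℝ cν.pu).neg
  have cM : ContDiffAt ℝ (⊤ : ℕ∞) (Mtil ν h) (u₀, 0) := (ch.inner ℝ cν.pu).neg
  have cN : ContDiffAt ℝ (⊤ : ℕ∞) (Ntil ν h) (u₀, 0) := (ch.inner ℝ cν.pv).neg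
  have cA : ContDiffAt ℝ (⊤ : ℕ∞) (Atil f ν h) (u₀, 0) := by
    unfold Atil
    fun_prop
  have cB : ContDiffAt ℝ (⊤ : ℕ∞) (Btil f ν h) (u₀, 0) := by
    unfold Btil
    refine ContDiffAt.sqrt (by fun_prop) ?_
    simp [hA0.ne']
  have cσ : ContDiffAt ℝ (⊤ : ℕ∞) σ (u₀, 0) := by
    refine ContDiffAt.div (by fun_prop) (cA.add cB) ?_
    rw [hB0]
    positivity
  have hW : FChat f ν h =ᶠ[𝓝 (u₀, 0)] fun q => f q + q.2 • (σ q • ν q) := by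
    filter_upwards [hUn] with q hq
    have hDq := hD q hq
    have hl : lam f ν q = q.2 * ‖cross3 (pu f q) (h q)‖ := by
      rw [lam, hfv q hq, hνdef q hq, det3_smul_self_cross3]
      field_simp
    simp only [FChat, σ, smul_smul, Etil, Gtil, Ftil, ← norm_cross3_sq]
    rw [hl, kaphat]
    congr 2
    rcases eq_or_ne (Atil f ν h q + Btil f ν h q) 0 with h0 | h0
    · simp [h0]
    · field_simp
  obtain ⟨j1, j2, j3, j4, j5⟩ := jet_add_snd_smul (g := fun q => σ q • ν q) cf (cσ.smul cν) ch
    (Filter.eventually_of_mem hUn hfv) hW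
  -- the values at the axis point
  have hDp := hD _ hp
  have hσ0 : σ (u₀, 0) =
      ‖cross3 (pu f (u₀, 0)) (h (u₀, 0))‖ ^ 2 / (‖pu f (u₀, 0)‖ ^ 2 * Ntil ν h (u₀, 0)) := by
    simp only [σ, hB0]
    simp only [Atil, Etil, Gtil, Ftil, ← norm_cross3_sq]
    field_simp
    ring
  have hσpos : 0 < σ (u₀, 0) := by
    rw [hσ0]
    positivity
  have hfuv : pv (pu f) (u₀, 0) = 0 := by
    have h1 : pv f =ᶠ[𝓝 (u₀, 0)] fun q => q.2 • h q := Filter.eventually_of_mem hUn hfv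
    rw [pv_pu_comm cf, h1.pu.eq_of_nhds, pu_snd_smul ch.differentiableAt_of_top]
    simp
  have hfνv : ⟪pu f (u₀, 0), pv ν (u₀, 0)⟫ = 0 := by
    have h1 : (fun q => ⟪pu f q, ν q⟫) =ᶠ[𝓝 (u₀, 0)] fun _ => (0 : ℝ) :=
      Filter.eventually_of_mem hUn ho1
    have h2 := h1.pv.eq_of_nhds
    have h3 : fderiv ℝ (pu f) (u₀, 0) (0, 1) = 0 := hfuv
    simpa [pv, fderiv_inner_apply ℝ cf.pu.differentiableAt_of_top cν.differentiableAt_of_top,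
      h3] using h2
  have hc : cross3 (pu f (u₀, 0)) (ν (u₀, 0)) = ‖cross3 (pu f (u₀, 0)) (h (u₀, 0))‖⁻¹ •
      (⟪pu f (u₀, 0), h (u₀, 0)⟫ • pu f (u₀, 0) - ‖pu f (u₀, 0)‖ ^ 2 • h (u₀, 0)) := by
    rw [hνdef _ hp, cross3_smul_right, cross3_cross3_self]
  have hνc : ⟪ν (u₀, 0), cross3 (pu f (u₀, 0)) (ν (u₀, 0))⟫ = 0 := by
    simp only [inner_E3, cross3_zero, cross3_one, cross3_two]
    ring
  have hνuc : ⟪pu ν (u₀, 0), cross3 (pu f (u₀, 0)) (ν (u₀, 0))⟫ =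
      (Etil f (u₀, 0) * Mtil ν h (u₀, 0) - Ftil f h (u₀, 0) * Ltil f ν (u₀, 0)) /
        ‖cross3 (pu f (u₀, 0)) (h (u₀, 0))‖ := by
    rw [hc, real_inner_smul_right, inner_sub_right, real_inner_smul_right, real_inner_smul_right,
      Etil, Mtil, Ftil, Ltil, real_inner_comm (pu f (u₀, 0)) (pu ν (u₀, 0)),
      real_inner_comm (h (u₀, 0)) (pu ν (u₀, 0))]
    ring
  have hνvc : ⟪pv ν (u₀, 0), cross3 (pu f (u₀, 0)) (ν (u₀, 0))⟫ =
      ‖pu f (u₀, 0)‖ ^ 2 * Ntil ν h (u₀, 0) / ‖cross3 (pu f (u₀, 0)) (h (u₀, 0))‖ := by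
    rw [hc, real_inner_smul_right, inner_sub_right, real_inner_smul_right, real_inner_smul_right,
      real_inner_comm (pu f (u₀, 0)) (pv ν (u₀, 0)), hfνv, Ntil,
      real_inner_comm (h (u₀, 0)) (pv ν (u₀, 0))]
    ring
  have hhc : ⟪h (u₀, 0), cross3 (pu f (u₀, 0)) (ν (u₀, 0))⟫ =
      -‖cross3 (pu f (u₀, 0)) (h (u₀, 0))‖ := by
    have h1 := norm_cross3_sq (pu f (u₀, 0)) (h (u₀, 0))
    rw [hc, real_inner_smul_right, inner_sub_right, real_inner_smul_right, real_inner_smul_right,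
      real_inner_self_eq_norm_sq, real_inner_comm (pu f (u₀, 0)) (h (u₀, 0))]
    field_simp
    linarith
  have hκs : ⟪pu (pu f) (u₀, 0), cross3 (pu f (u₀, 0)) (ν (u₀, 0))⟫ =
      -kappas f ν u₀ * ‖pu f (u₀, 0)‖ ^ 3 := by
    rw [kappas, det3_swap]
    field_simp
  have hκc : kappac f ν h u₀ ^ 2 = 4 * ‖pu f (u₀, 0)‖ ^ 3 * Ntil ν h (u₀, 0) ^ 2 /
      ‖cross3 (pu f (u₀, 0)) (h (u₀, 0))‖ ^ 3 := by
    simp only [kappac, Etil, Gtil, Ftil]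
    rw [← norm_cross3_sq, div_pow, mul_pow, mul_pow, rpow_three_quarters_sq (norm_nonneg _),
      rpow_three_quarters_sq (norm_nonneg _)]
    norm_num
  have hκt : Etil f (u₀, 0) * Mtil ν h (u₀, 0) - Ftil f h (u₀, 0) * Ltil f ν (u₀, 0) =
      kappat f ν h u₀ * (‖pu f (u₀, 0)‖ ^ 2 * ‖cross3 (pu f (u₀, 0)) (h (u₀, 0))‖) := by
    rw [kappat]
    simp only [Gtil, Etil, Ftil]
    rw [← norm_cross3_sq, Real.sqrt_sq hDp.le]
    field_simp
  rw [gaussK_eq_of_jet ha hDp hσpos (hνdef _ hp) j1 j2, j3, j4, j5,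
    pu_smul cσ.differentiableAt_of_top cν.differentiableAt_of_top,
    pv_smul cσ.differentiableAt_of_top cν.differentiableAt_of_top]
  simp only [inner_add_left, real_inner_smul_left, hνc, hνuc, hνvc, hhc, hκs, hκc, hκt, hσ0]
  field_simp
  ring

/-- a point `p = (u₀,0)` of the u-axis is an elliptic (resp. parabolic,
hyperbolic) point of the focal surface `ŴFC_f` iff `4κ_t² + κ_sκ_c²` is negative
(resp. zero, positive) at `u₀`. -/
theorem stmt15
    (U : Set (ℝ × ℝ)) (hU : IsOpen U)
    (f ν h : ℝ × ℝ → E3)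
    (hf : ContDiffOn ℝ (⊤ : ℕ∞) f U) (hν : ContDiffOn ℝ (⊤ : ℕ∞) ν U) (hhsm : ContDiffOn ℝ (⊤ : ℕ∞) h U)
    (hax : ∃ p ∈ U, p.2 = (0 : ℝ))
    (hν1 : ∀ p ∈ U, ‖ν p‖ = 1)
    (ho1 : ∀ p ∈ U, (⟪pu f p, ν p⟫ : ℝ) = 0)
    (ho2 : ∀ p ∈ U, (⟪pv f p, ν p⟫ : ℝ) = 0)
    (hfront : ∀ p ∈ U, Function.Injective ⇑(fderiv ℝ (fun q => (f q, ν q)) p))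
    (hlam : ∀ p ∈ U, (lam f ν p = 0 ↔ p.2 = 0))
    (hh0 : ∀ p ∈ U, h p ≠ 0)
    (hfv : ∀ p ∈ U, pv f p = p.2 • h p)
    (hνdef : ∀ p ∈ U, ν p = ‖cross3 (pu f p) (h p)‖⁻¹ • cross3 (pu f p) (h p))
    (hNpos : ∀ p ∈ U, p.2 = 0 → 0 < Ntil ν h p)
    (u₀ : ℝ) (hp : ((u₀, 0) : ℝ × ℝ) ∈ U) :
    (0 < gaussK (FChat f ν h) (u₀, 0) ↔
      4 * (kappat f ν h u₀) ^ 2 + kappas f ν u₀ * (kappac f ν h u₀) ^ 2 < 0) ∧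
    (gaussK (FChat f ν h) (u₀, 0) = 0 ↔
      4 * (kappat f ν h u₀) ^ 2 + kappas f ν u₀ * (kappac f ν h u₀) ^ 2 = 0) ∧
    (gaussK (FChat f ν h) (u₀, 0) < 0 ↔
      0 < 4 * (kappat f ν h u₀) ^ 2 + kappas f ν u₀ * (kappac f ν h u₀) ^ 2) := by
  rw [gaussK_FChat_eq hU hf hν hhsm hν1 ho1 hfv hνdef hNpos hp]
  refine ⟨⟨fun _ => by linarith, fun _ => by linarith⟩,
    ⟨fun _ => by linarith, fun _ => by linarith⟩, ⟨fun _ => by linarith, fun _ => by linarith⟩⟩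
end
end

section
/- Under the adapted cuspidal-edge setting, consider the singular locus γ̂(u) = f(u,0) as a curve on the focal surface ŴFC_f, whose unit normal along γ̂ is n(u) = (f_u×ν)/|f_u| evaluated at (u,0). Then at every u the geodesic curvature κ_g(u) = ⟨γ̂″(u), n(u)×γ̂′(u)⟩/|γ̂′(u)|³ equals the limiting normal curvature κ_ν(u), and the normal curvature κ_n(u) = ⟨γ̂″(u), n(u)⟩/|γ̂′(u)|² equals −κ_s(u). -/
noncomputable section

local notation "⟪" x ", " y "⟫" => @inner ℝ _ _ x y

/-- The singular locus `γ̂(u) = f(u,0)`. -/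
def gamhat (f : ℝ × ℝ → E3) (u : ℝ) : E3 := f (u, 0)

/-- The unit normal `n = (f_u×ν)/|f_u|` of the focal surface along the singular curve. -/
def ncrv (f ν : ℝ × ℝ → E3) (u : ℝ) : E3 :=
  ‖pu f (u, 0)‖⁻¹ • cross3 (pu f (u, 0)) (ν (u, 0))

/-- Geodesic curvature `κ_g = ⟨γ̂″, n×γ̂′⟩/|γ̂′|³` of `γ̂` on the focal surface. -/
def geokg (f ν : ℝ × ℝ → E3) (u : ℝ) : ℝ :=
  ⟪deriv (deriv (gamhat f)) u, cross3 (ncrv f ν u) (deriv (gamhat f) u)⟫ /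
    ‖deriv (gamhat f) u‖ ^ 3

/-- Normal curvature `κ_n = ⟨γ̂″, n⟩/|γ̂′|²` of `γ̂` on the focal surface. -/
def norkn (f ν : ℝ × ℝ → E3) (u : ℝ) : ℝ :=
  ⟪deriv (deriv (gamhat f)) u, ncrv f ν u⟫ / ‖deriv (gamhat f) u‖ ^ 2

/-- Limiting normal curvature `κ_ν = ⟨f_uu, ν⟩/|f_u|²` along the u-axis. -/
def kappanu (f ν : ℝ × ℝ → E3) (u : ℝ) : ℝ :=
  ⟪pu (pu f) (u, 0), ν (u, 0)⟫ / ‖pu f (u, 0)‖ ^ 2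


lemma e3_apply_zero (a b c : ℝ) : e3 a b c 0 = a := rfl

lemma e3_apply_one (a b c : ℝ) : e3 a b c 1 = b := rfl

lemma e3_apply_two (a b c : ℝ) : e3 a b c 2 = c := rfl

lemma inner_e3_eq (x y : E3) : ⟪x, y⟫ = x 0 * y 0 + x 1 * y 1 + x 2 * y 2 := by
  simp only [PiLp.inner_apply, Fin.sum_univ_three, RCLike.inner_apply, conj_trivial]
  ring

lemma inner_cross3_eq_neg_det3 (a b c : E3) : ⟪b, cross3 a c⟫ = -det3 a b c := by
  simp only [det3, cross3, inner_e3_eq, e3_apply_zero, e3_apply_one, e3_apply_two]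
  ring

lemma cross3_smul_left (r : ℝ) (a b : E3) : cross3 (r • a) b = r • cross3 a b := by
  ext i
  fin_cases i <;>
    simp [cross3, e3] <;> ring

lemma inner_cross3_cross3 (a b c : E3) :
    ⟪b, cross3 (cross3 a c) a⟫ = ⟪a, a⟫ * ⟪b, c⟫ - ⟪a, c⟫ * ⟪b, a⟫ := by
  simp only [cross3, inner_e3_eq, e3_apply_zero, e3_apply_one, e3_apply_two]
  ring

lemma deriv_comp_prodMk_zero {g : ℝ × ℝ → E3} {u : ℝ} (hg : DifferentiableAt ℝ g (u, 0)) :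
    deriv (fun t : ℝ => g (t, 0)) u = pu g (u, 0) :=
  (hg.hasFDerivAt.comp_hasDerivAt u
    ((hasDerivAt_id u).prodMk (hasDerivAt_const u (0 : ℝ)))).deriv

lemma deriv_gamhat {U : Set (ℝ × ℝ)} (hU : IsOpen U) {f : ℝ × ℝ → E3}
    (hf : ContDiffOn ℝ (⊤ : ℕ∞) f U) {u : ℝ} (hu : ((u, 0) : ℝ × ℝ) ∈ U) :
    deriv (gamhat f) u = pu f (u, 0) :=
  deriv_comp_prodMk_zero ((hf.contDiffAt (hU.mem_nhds hu)).differentiableAt (by simp))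

lemma deriv_deriv_gamhat {U : Set (ℝ × ℝ)} (hU : IsOpen U) {f : ℝ × ℝ → E3}
    (hf : ContDiffOn ℝ (⊤ : ℕ∞) f U) {u : ℝ} (hu : ((u, 0) : ℝ × ℝ) ∈ U) :
    deriv (deriv (gamhat f)) u = pu (pu f) (u, 0) := by
  have hev : deriv (gamhat f) =ᶠ[nhds u] fun t => pu f (t, 0) := by
    have hc : Continuous fun t : ℝ => ((t, 0) : ℝ × ℝ) := by fun_prop
    filter_upwards [(hU.preimage hc).mem_nhds hu] with t ht
    exact deriv_gamhat hU hf ht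
  rw [hev.deriv_eq]
  refine deriv_comp_prodMk_zero ?_
  have hd : ContDiffAt ℝ 1 (fderiv ℝ f) (u, 0) :=
    (hf.contDiffAt (hU.mem_nhds hu)).fderiv_right (WithTop.coe_le_coe.2 le_top)
  exact (hd.differentiableAt one_ne_zero).clm_apply (differentiableAt_const _)

/-- along the singular locus `γ̂(u) = f(u,0)`, viewed on the focal surface
`ŴFC_f` with unit normal `n = (f_u×ν)/|f_u|`, the geodesic curvature equals the limiting
normal curvature `κ_ν` and the normal curvature equals `−κ_s`. -/
theorem stmt18
    (U : Set (ℝ × ℝ)) (hU : IsOpen U)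
    (f ν h : ℝ × ℝ → E3)
    (hf : ContDiffOn ℝ (⊤ : ℕ∞) f U) (hν : ContDiffOn ℝ (⊤ : ℕ∞) ν U) (hhsm : ContDiffOn ℝ (⊤ : ℕ∞) h U)
    (hax : ∃ p ∈ U, p.2 = (0 : ℝ))
    (hν1 : ∀ p ∈ U, ‖ν p‖ = 1)
    (ho1 : ∀ p ∈ U, (⟪pu f p, ν p⟫ : ℝ) = 0)
    (ho2 : ∀ p ∈ U, (⟪pv f p, ν p⟫ : ℝ) = 0)
    (hfront : ∀ p ∈ U, Function.Injective ⇑(fderiv ℝ (fun q => (f q, ν q)) p))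
    (hlam : ∀ p ∈ U, (lam f ν p = 0 ↔ p.2 = 0))
    (hh0 : ∀ p ∈ U, h p ≠ 0)
    (hfv : ∀ p ∈ U, pv f p = p.2 • h p)
    (hνdef : ∀ p ∈ U, ν p = ‖cross3 (pu f p) (h p)‖⁻¹ • cross3 (pu f p) (h p))
    (hNpos : ∀ p ∈ U, p.2 = 0 → 0 < Ntil ν h p) :
    ∀ u : ℝ, ((u, 0) : ℝ × ℝ) ∈ U →
      geokg f ν u = kappanu f ν u ∧ norkn f ν u = -(kappas f ν u) := by
  intro u hu
  simp only [geokg, norkn, kappanu, kappas, ncrv, deriv_gamhat hU hf hu,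
    deriv_deriv_gamhat hU hf hu, cross3_smul_left, inner_smul_right]
  rw [inner_cross3_cross3, inner_cross3_eq_neg_det3, ho1 _ hu, real_inner_self_eq_norm_sq]
  by_cases h0 : ‖pu f (u, 0)‖ = 0
  · simp [h0]
  · constructor <;> field_simp
    ring
end
end
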